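/- arXiv:1102.1714 — 2 statements merged into one kernel-verified Lean document; each statement's English description precedes it below -/
import Mathlib

section
/- Through each point p of the Segre variety S_{1,1,1}(2) there pass exactly 3 generator lines (lines entirely contained in S) and exactly 12 bisecant lines lying in one of the three S_{1,1}(2) subvarieties through p, together covering 7 + 12 = 19 points of S including p; the remaining 8 points of S each lie on a distinct further bisecant through p, giving 8 additional secant lines. In total S has 108 bisecant lines that do not lie inside any of the nine S_{1,1}(2) subvarieties. -/
/-- Index set for coordinates of `V_2 ⊗ V_2 ⊗ V_2` over `GF(2)`. -/
abbrev ι3 := Fin 2 × Fin 2 × Fin 2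

/-- `V_8 = V(2,2) ⊗ V(2,2) ⊗ V(2,2)`, realized in coordinates as `GF(2)^(2×2×2)`. -/
abbrev V8 := ι3 → ZMod 2

/-- The Segre variety `S_{1,1,1}(2)`: the nonzero decomposable tensors `u ⊗ v ⊗ w`. -/
def Segre : Set V8 :=
  {x | x ≠ 0 ∧ ∃ u v w : Fin 2 → ZMod 2, x = fun p => u p.1 * v p.2.1 * w p.2.2}

/-- A line of `PG(7,2)`: the three nonzero points of a 2-dimensional subspace. -/
def IsLine (L : Set V8) : Prop :=
  ∃ p q : V8, p ≠ 0 ∧ q ≠ 0 ∧ p ≠ q ∧ L = {p, q, p + q}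

/-- A bisecant of the Segre variety: a line meeting it in exactly 2 points. -/
def IsBisecant (L : Set V8) : Prop :=
  IsLine L ∧ (L ∩ Segre).ncard = 2

/-- The nine `S_{1,1}(2)` subvarieties of the Segre variety, obtained by fixing one
tensor slot at one of the three points of `PG(1,2)`. -/
def SigmaSub : Set (Set V8) :=
  {σ | ∃ u : Fin 2 → ZMod 2, u ≠ 0 ∧
    (σ = {x ∈ Segre | ∃ v w : Fin 2 → ZMod 2, x = fun p => u p.1 * v p.2.1 * w p.2.2} ∨
     σ = {x ∈ Segre | ∃ v w : Fin 2 → ZMod 2, x = fun p => v p.1 * u p.2.1 * w p.2.2} ∨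
     σ = {x ∈ Segre | ∃ v w : Fin 2 → ZMod 2, x = fun p => v p.1 * w p.2.1 * u p.2.2})}

abbrev T3 := Fin 3 × Fin 3 × Fin 3

def ff : Fin 3 → Fin 2 → ZMod 2 := ![![1,0],![0,1],![1,1]]

def ee (a : T3) : V8 := fun p => ff a.1 p.1 * ff a.2.1 p.2.1 * ff a.2.2 p.2.2

def dd (a b : T3) : ℕ :=
  (if a.1 = b.1 then 0 else 1) + (if a.2.1 = b.2.1 then 0 else 1) + (if a.2.2 = b.2.2 then 0 else 1)

def QQ (x : V8) : Prop := ∀ i j k l m n : Fin 2,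
  x (i,k,m) * x (j,l,n) = x (j,k,m) * x (i,l,n) ∧
  x (i,k,m) * x (j,l,n) = x (i,l,m) * x (j,k,n)

instance (x : V8) : Decidable (QQ x) := by unfold QQ; infer_instance

def thd (a b : T3) : T3 := (-(a.1+b.1), -(a.2.1+b.2.1), -(a.2.2+b.2.2))

def lin (a b : T3) : Set V8 := {ee a, ee b, ee a + ee b}

theorem segre_QQ {x : V8} (h : x ∈ Segre) : QQ x := by
  obtain ⟨_, u, v, w, rfl⟩ := h
  intro i j k l m n
  constructor <;> ring

theorem ff_surj : ∀ u : Fin 2 → ZMod 2, u ≠ 0 → ∃ i, u = ff i := by decide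
theorem ee_ne : ∀ a, ee a ≠ 0 := by decide +kernel
theorem ee_inj' : ∀ a b, ee a = ee b → a = b := by decide +kernel
theorem thd_eq : ∀ a b, dd a b = 1 → ee a + ee b = ee (thd a b) := by decide +kernel
theorem not_QQ : ∀ a b, 2 ≤ dd a b → ¬ QQ (ee a + ee b) := by decide +kernel

theorem ee_mem (a : T3) : ee a ∈ Segre := ⟨ee_ne a, _, _, _, rfl⟩

theorem tens_of_ne {u v w : Fin 2 → ZMod 2} (h : (fun p : ι3 => u p.1 * v p.2.1 * w p.2.2) ≠ 0) :
    ∃ i j k, u = ff i ∧ v = ff j ∧ w = ff k := by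
  obtain ⟨i, hi⟩ := ff_surj u (by rintro rfl; apply h; funext p; simp)
  obtain ⟨j, hj⟩ := ff_surj v (by rintro rfl; apply h; funext p; simp)
  obtain ⟨k, hk⟩ := ff_surj w (by rintro rfl; apply h; funext p; simp)
  exact ⟨i, j, k, hi, hj, hk⟩

theorem ee_eq {a : T3} {u v w : Fin 2 → ZMod 2}
    (h : ee a = fun p : ι3 => u p.1 * v p.2.1 * w p.2.2) :
    u = ff a.1 ∧ v = ff a.2.1 ∧ w = ff a.2.2 := by
  obtain ⟨i, j, k, rfl, rfl, rfl⟩ := tens_of_ne (h ▸ ee_ne a)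
  have := ee_inj' a (i, j, k) h
  subst this
  exact ⟨rfl, rfl, rfl⟩

theorem segre_eq {x : V8} (h : x ∈ Segre) : ∃ a, x = ee a := by
  obtain ⟨h0, u, v, w, rfl⟩ := h
  obtain ⟨i, j, k, rfl, rfl, rfl⟩ := tens_of_ne h0
  exact ⟨(i, j, k), rfl⟩

theorem ff_inj : ∀ i j, ff i = ff j → i = j := by decide
theorem ff_ne : ∀ i, ff i ≠ 0 := by decide

theorem sigma_iff (a b : T3) : (∃ σ ∈ SigmaSub, ({ee a, ee b} : Set V8) ⊆ σ) ↔ dd a b ≤ 2 := by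
  constructor
  · rintro ⟨σ, ⟨u, hu, h⟩, hs⟩
    have ha : ee a ∈ σ := hs (by simp)
    have hb : ee b ∈ σ := hs (by simp)
    rcases h with rfl | rfl | rfl <;> obtain ⟨-, v, w, h1⟩ := ha <;>
      obtain ⟨-, v', w', h2⟩ := hb <;> have h1 := ee_eq h1 <;> have h2 := ee_eq h2
    · have := ff_inj _ _ (h1.1.symm.trans h2.1)
      unfold dd; split_ifs <;> simp_all
    · have := ff_inj _ _ (h1.2.1.symm.trans h2.2.1)
      unfold dd; split_ifs <;> simp_all
    · have := ff_inj _ _ (h1.2.2.symm.trans h2.2.2)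
      unfold dd; split_ifs <;> simp_all
  · intro h
    have : a.1 = b.1 ∨ a.2.1 = b.2.1 ∨ a.2.2 = b.2.2 := by
      by_contra hc
      push Not at hc
      simp [dd, hc.1, hc.2.1, hc.2.2] at h
    rcases this with h | h | h
    · refine ⟨_, ⟨ff a.1, ff_ne _, Or.inl rfl⟩, ?_⟩
      rintro x (rfl | rfl)
      · exact ⟨ee_mem _, _, _, rfl⟩
      · exact ⟨ee_mem _, ff b.2.1, ff b.2.2, by rw [h]; rfl⟩
    · refine ⟨_, ⟨ff a.2.1, ff_ne _, Or.inr (Or.inl rfl)⟩, ?_⟩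
      rintro x (rfl | rfl)
      · exact ⟨ee_mem _, _, _, rfl⟩
      · exact ⟨ee_mem _, ff b.1, ff b.2.2, by rw [h]; rfl⟩
    · refine ⟨_, ⟨ff a.2.2, ff_ne _, Or.inr (Or.inr rfl)⟩, ?_⟩
      rintro x (rfl | rfl)
      · exact ⟨ee_mem _, _, _, rfl⟩
      · exact ⟨ee_mem _, ff b.1, ff b.2.1, by rw [h]; rfl⟩

theorem dd_self (a : T3) : dd a a = 0 := by simp [dd]
theorem dd_zero {a b : T3} (h : dd a b = 0) : a = b := by
  unfold dd at h
  split_ifs at h with h1 h2 h3 <;> first | omega | exact Prod.ext h1 (Prod.ext h2 h3)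
theorem dd_le (a b : T3) : dd a b ≤ 3 := by unfold dd; split_ifs <;> simp

theorem lin_isLine {a b : T3} (h : a ≠ b) : IsLine (lin a b) :=
  ⟨ee a, ee b, ee_ne a, ee_ne b, fun h' => h (ee_inj' _ _ h'), rfl⟩

theorem lin_inter {a b : T3} (h : 2 ≤ dd a b) : lin a b ∩ Segre = {ee a, ee b} := by
  ext x
  constructor
  · rintro ⟨rfl | rfl | rfl, hx⟩
    · simp
    · simp
    · exact absurd (segre_QQ hx) (not_QQ a b h)
  · rintro (rfl | rfl)
    · exact ⟨by simp [lin], ee_mem _⟩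
    · exact ⟨by simp [lin], ee_mem _⟩

theorem lin_sub {a b : T3} (h : dd a b = 1) : lin a b = {ee a, ee b, ee (thd a b)} := by
  rw [lin, thd_eq a b h]

theorem lin_sub' {a b : T3} (h : dd a b = 1) : lin a b ⊆ Segre := by
  rw [lin_sub h]
  rintro x (rfl | rfl | rfl) <;> exact ee_mem _

theorem lin_bisec {a b : T3} (h : 2 ≤ dd a b) : IsBisecant (lin a b) := by
  have hab : a ≠ b := by rintro rfl; simp [dd_self] at h
  refine ⟨lin_isLine hab, ?_⟩
  rw [lin_inter h, Set.ncard_pair (fun h' => hab (ee_inj' _ _ h'))]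

theorem v8_self (x : V8) : x + x = 0 := CharTwo.add_self_eq_zero x

theorem line_thru {L : Set V8} (hL : IsLine L) {p : V8} (hp : p ∈ L) :
    ∃ q, q ≠ p ∧ L = {p, q, p + q} := by
  obtain ⟨x, y, hx, hy, hxy, rfl⟩ := hL
  rcases hp with rfl | rfl | rfl
  · exact ⟨y, hxy.symm, rfl⟩
  · refine ⟨x, hxy, ?_⟩
    rw [add_comm, Set.insert_comm]
  · refine ⟨x, by simpa using hy, ?_⟩
    have : x + y + x = y := by rw [add_comm x y, add_assoc, v8_self, add_zero]
    rw [this]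
    ext z; simp only [Set.mem_insert_iff, Set.mem_singleton_iff]; tauto

theorem line_two {L : Set V8} (hL : IsLine L) {a b : T3} (ha : ee a ∈ L) (hb : ee b ∈ L)
    (hab : a ≠ b) : L = lin a b := by
  obtain ⟨q, hq, rfl⟩ := line_thru hL ha
  rcases hb with h | h | h
  · exact absurd (ee_inj' _ _ h).symm hab
  · rw [← h]; rfl
  · have : q = ee a + ee b := by rw [h, ← add_assoc, v8_self, zero_add]
    have h2 : ee a + q = ee b := h.symm
    rw [h2, this, lin]
    ext z; simp only [Set.mem_insert_iff, Set.mem_singleton_iff]; tauto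

theorem gen_iff (a : T3) (L : Set V8) :
    (IsLine L ∧ ee a ∈ L ∧ L ⊆ Segre) ↔ ∃ b, dd a b = 1 ∧ L = lin a b := by
  constructor
  · rintro ⟨hL, ha, hs⟩
    obtain ⟨q, hq, hLq⟩ := line_thru hL ha
    have hqL : q ∈ L := by rw [hLq]; simp
    obtain ⟨b, rfl⟩ := segre_eq (hs hqL)
    have hab : a ≠ b := by rintro rfl; exact hq rfl
    have := line_two hL ha hqL hab
    refine ⟨b, ?_, this⟩
    by_contra hd
    have h2 : 2 ≤ dd a b := by
      have : dd a b ≠ 0 := fun h => hab (dd_zero h)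
      omega
    refine not_QQ a b h2 (segre_QQ (hs ?_))
    rw [this]; simp [lin]
  · rintro ⟨b, h, rfl⟩
    exact ⟨lin_isLine (by rintro rfl; simp [dd_self] at h), by simp [lin], lin_sub' h⟩

theorem bis_ex {L : Set V8} (hL : IsBisecant L) : ∃ a b, 2 ≤ dd a b ∧ L = lin a b := by
  obtain ⟨hL, hc⟩ := hL
  obtain ⟨x, y, hxy, he⟩ := Set.ncard_eq_two.1 hc
  have hx : x ∈ L ∩ Segre := by rw [he]; simp
  have hy : y ∈ L ∩ Segre := by rw [he]; simp
  obtain ⟨a, rfl⟩ := segre_eq hx.2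
  obtain ⟨b, rfl⟩ := segre_eq hy.2
  have hab : a ≠ b := by rintro rfl; exact hxy rfl
  have h := line_two hL hx.1 hy.1 hab
  refine ⟨a, b, ?_, h⟩
  by_contra hd
  have h1 : dd a b = 1 := by
    have : dd a b ≠ 0 := fun h => hab (dd_zero h)
    omega
  have h3 : ee a + ee b ∈ L ∩ Segre := by
    have : ee a + ee b ∈ lin a b := by simp [lin]
    exact ⟨h ▸ this, lin_sub' h1 this⟩
  rw [he] at h3
  rcases h3 with h3 | h3
  · exact ee_ne b (by simpa using h3)
  · exact ee_ne a (by simpa using h3)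

theorem lin_comm (a b : T3) : lin a b = lin b a := by
  rw [lin, lin, Set.insert_comm, add_comm]

theorem dd_comm (a b : T3) : dd a b = dd b a := by
  unfold dd; simp only [eq_comm]

theorem bis_iff (a : T3) (L : Set V8) :
    (IsBisecant L ∧ ee a ∈ L) ↔ ∃ b, 2 ≤ dd a b ∧ L = lin a b := by
  constructor
  · rintro ⟨hL, ha⟩
    obtain ⟨c, b, h, rfl⟩ := bis_ex hL
    have : ee a ∈ lin c b ∩ Segre := ⟨ha, ee_mem a⟩
    rw [lin_inter h] at this
    rcases this with h' | h'
    · rw [ee_inj' _ _ h']; exact ⟨b, h, rfl⟩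
    · rw [ee_inj' _ _ h']; exact ⟨c, by rwa [dd_comm], lin_comm _ _⟩
  · rintro ⟨b, h, rfl⟩
    exact ⟨lin_bisec h, by simp [lin]⟩

theorem in_iff (a : T3) (L : Set V8) :
    (IsBisecant L ∧ ee a ∈ L ∧ ∃ σ ∈ SigmaSub, L ∩ Segre ⊆ σ) ↔ ∃ b, dd a b = 2 ∧ L = lin a b := by
  rw [← and_assoc, bis_iff]
  constructor
  · rintro ⟨⟨b, h, rfl⟩, hs⟩
    rw [lin_inter h, sigma_iff] at hs
    exact ⟨b, le_antisymm hs h, rfl⟩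
  · rintro ⟨b, h, rfl⟩
    refine ⟨⟨b, h.ge, rfl⟩, ?_⟩
    rw [lin_inter h.ge, sigma_iff]; exact h.le

theorem out_iff (a : T3) (L : Set V8) :
    (IsBisecant L ∧ ee a ∈ L ∧ ¬∃ σ ∈ SigmaSub, L ∩ Segre ⊆ σ) ↔ ∃ b, dd a b = 3 ∧ L = lin a b := by
  rw [← and_assoc, bis_iff]
  constructor
  · rintro ⟨⟨b, h, rfl⟩, hs⟩
    rw [lin_inter h, sigma_iff] at hs
    have := dd_le a b
    exact ⟨b, by omega, rfl⟩
  · rintro ⟨b, h, rfl⟩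
    have h2 : 2 ≤ dd a b := by omega
    refine ⟨⟨b, h2, rfl⟩, ?_⟩
    rw [lin_inter h2, sigma_iff]; omega

theorem lin_inj {a b c : T3} (hb : 2 ≤ dd a b) (hc : 2 ≤ dd a c) (h : lin a b = lin a c) :
    b = c := by
  have h1 : ee b ∈ lin a c ∩ Segre := by
    rw [← h]; exact ⟨by simp [lin], ee_mem _⟩
  rw [lin_inter hc] at h1
  rcases h1 with h1 | h1
  · have := ee_inj' _ _ h1
    subst this; simp [dd_self] at hb
  · exact ee_inj' _ _ h1

theorem count_lin (a : T3) (n k : ℕ) (hn : 2 ≤ n)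
    (hk : (Finset.univ.filter fun b => dd a b = n).card = k) :
    {L : Set V8 | ∃ b, dd a b = n ∧ L = lin a b}.ncard = k := by
  have : {L : Set V8 | ∃ b, dd a b = n ∧ L = lin a b} =
      lin a '' ((Finset.univ.filter fun b => dd a b = n : Finset T3) : Set T3) := by
    ext L; simp [eq_comm]
  rw [this, Set.ncard_image_of_injOn, Set.ncard_coe_finset, hk]
  intro b hb c hc h
  simp at hb hc
  exact lin_inj (by omega) (by omega) h

def bs (a : T3) : Finset T3 := {(a.1+1, a.2), (a.1, a.2.1+1, a.2.2), (a.1, a.2.1, a.2.2+1)}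

theorem bs_card : ∀ a, (bs a).card = 3 := by decide +kernel
theorem bs_dd : ∀ a, ∀ b ∈ bs a, dd a b = 1 := by decide +kernel
theorem bs_ex : ∀ a b, dd a b = 1 → b ∈ bs a ∨ thd a b ∈ bs a := by decide +kernel
theorem thd_thd : ∀ a b, dd a b = 1 → thd a (thd a b) = b := by decide +kernel
theorem bs_thd : ∀ a, ∀ b ∈ bs a, thd a b ∉ bs a := by decide +kernel
theorem c2 : ∀ a, (Finset.univ.filter fun b => dd a b = 2).card = 12 := by decide +kernel
theorem c3 : ∀ a, (Finset.univ.filter fun b => dd a b = 3).card = 8 := by decide +kernel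
theorem c19 : ∀ a, (Finset.univ.filter fun b => dd a b ≤ 2).card = 19 := by decide +kernel
theorem c108 : (Finset.univ.filter fun x : T3 × T3 => x.1.1 < x.2.1 ∧ dd x.1 x.2 = 3).card = 108 := by
  decide +kernel

theorem count_gen (a : T3) :
    {L : Set V8 | ∃ b, dd a b = 1 ∧ L = lin a b}.ncard = 3 := by
  have : {L : Set V8 | ∃ b, dd a b = 1 ∧ L = lin a b} = lin a '' (bs a : Set T3) := by
    ext L
    constructor
    · rintro ⟨b, h, rfl⟩
      rcases bs_ex a b h with hb | hb
      · exact ⟨b, hb, rfl⟩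
      · refine ⟨_, hb, ?_⟩
        rw [lin_sub (bs_dd _ _ hb), lin_sub h, thd_thd a b h]
        ext z; simp only [Set.mem_insert_iff, Set.mem_singleton_iff]; tauto
    · rintro ⟨b, h, rfl⟩
      exact ⟨b, bs_dd _ _ h, rfl⟩
  rw [this, Set.ncard_image_of_injOn, Set.ncard_coe_finset, bs_card]
  intro b hb c hc h
  have hb' := bs_dd _ _ hb
  have h1 : ee b ∈ lin a c := by rw [← h]; simp [lin]
  rw [lin_sub (bs_dd _ _ hc)] at h1
  rcases h1 with h1 | h1 | h1 <;> have h1 := ee_inj' _ _ h1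
  · rw [h1, dd_self] at hb'; omega
  · exact h1
  · subst h1; exact absurd hb (bs_thd _ _ hc)

theorem cover_iff (a c : T3) :
    (ee c ∈ ⋃ L ∈ {L : Set V8 | (IsLine L ∧ ee a ∈ L ∧ L ⊆ Segre) ∨
          (IsBisecant L ∧ ee a ∈ L ∧ ∃ σ ∈ SigmaSub, L ∩ Segre ⊆ σ)}, L) ↔ dd a c ≤ 2 := by
  simp only [gen_iff, in_iff, Set.mem_iUnion, Set.mem_setOf_eq, exists_prop]
  constructor
  · rintro ⟨L, ⟨b, h, rfl⟩ | ⟨b, h, rfl⟩, hc⟩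
    · rw [lin_sub h] at hc
      have ht : ∀ a b, dd a b = 1 → dd a (thd a b) ≤ 2 := by decide +kernel
      rcases hc with hc | hc | hc <;> rw [ee_inj' _ _ hc]
      · simp [dd_self]
      · omega
      · exact ht _ _ h
    · have : ee c ∈ lin a b ∩ Segre := ⟨hc, ee_mem c⟩
      rw [lin_inter h.ge] at this
      rcases this with hc | hc <;> rw [ee_inj' _ _ hc]
      · simp [dd_self]
      · omega
  · intro h
    have : dd a c = 0 ∨ dd a c = 1 ∨ dd a c = 2 := by omega
    rcases this with h | h | h
    · rw [← dd_zero h]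
      have : (a.1+1, a.2) ∈ bs a := by simp [bs]
      exact ⟨_, Or.inl ⟨_, bs_dd _ _ this, rfl⟩, by simp [lin]⟩
    · exact ⟨_, Or.inl ⟨_, h, rfl⟩, by simp [lin]⟩
    · exact ⟨_, Or.inr ⟨_, h, rfl⟩, by simp [lin]⟩

theorem count_all :
    {L : Set V8 | IsBisecant L ∧ ¬∃ σ ∈ SigmaSub, L ∩ Segre ⊆ σ}.ncard = 108 := by
  have : {L : Set V8 | IsBisecant L ∧ ¬∃ σ ∈ SigmaSub, L ∩ Segre ⊆ σ} =
      (fun x : T3 × T3 => lin x.1 x.2) '' ((Finset.univ.filter fun x : T3 × T3 =>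
        x.1.1 < x.2.1 ∧ dd x.1 x.2 = 3 : Finset (T3 × T3)) : Set (T3 × T3)) := by
    ext L
    simp only [Finset.coe_filter, Finset.mem_univ, true_and, Set.mem_image, Set.mem_setOf_eq]
    constructor
    · rintro ⟨hb, hs⟩
      obtain ⟨a, b, h, rfl⟩ := bis_ex hb
      rw [lin_inter h, sigma_iff] at hs
      have h3 : dd a b = 3 := by have := dd_le a b; omega
      have hne : a.1 ≠ b.1 := by
        intro hh
        unfold dd at h3
        rw [if_pos hh] at h3
        split_ifs at h3 <;> omega
      rcases lt_or_gt_of_ne hne with hl | hl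
      · exact ⟨(a, b), ⟨hl, h3⟩, rfl⟩
      · exact ⟨(b, a), ⟨hl, by rw [dd_comm]; exact h3⟩, lin_comm _ _⟩
    · rintro ⟨⟨a, b⟩, ⟨-, h⟩, rfl⟩
      have := (out_iff a _).2 ⟨b, h, rfl⟩
      exact ⟨this.1, this.2.2⟩
  rw [this, Set.ncard_image_of_injOn, Set.ncard_coe_finset, c108]
  rintro ⟨a, b⟩ hx ⟨c, d⟩ hy h
  simp only [Finset.coe_filter, Finset.mem_univ, true_and, Set.mem_setOf_eq] at hx hy h
  have h1 : ee a ∈ lin c d ∩ Segre := by rw [← h]; exact ⟨by simp [lin], ee_mem _⟩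
  have h2 : ee b ∈ lin c d ∩ Segre := by rw [← h]; exact ⟨by simp [lin], ee_mem _⟩
  rw [lin_inter (by omega)] at h1 h2
  rcases h1 with h1 | h1 <;> rcases h2 with h2 | h2 <;>
    have h1 := ee_inj' _ _ h1 <;> have h2 := ee_inj' _ _ h2 <;> subst h1 <;> subst h2
  · exact absurd hx.1 (lt_irrefl _)
  · rfl
  · exact absurd hx.1 (lt_asymm hy.1)
  · exact absurd hx.1 (lt_irrefl _)

/-- Through each point `p` of `S = S_{1,1,1}(2)` there pass exactly 3 generator lines and
exactly 12 bisecants lying in one of the three `S_{1,1}(2)` subvarieties through `p`;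
together these cover 19 points of `S` (including `p`), and the remaining 8 points of `S`
give 8 further bisecants through `p`.  In total `S` has 108 bisecants not lying in any of
the nine `S_{1,1}(2)` subvarieties. -/
theorem stmt13 :
    (∀ p ∈ Segre,
      {L : Set V8 | IsLine L ∧ p ∈ L ∧ L ⊆ Segre}.ncard = 3 ∧
      {L : Set V8 | IsBisecant L ∧ p ∈ L ∧ ∃ σ ∈ SigmaSub, L ∩ Segre ⊆ σ}.ncard = 12 ∧
      (Segre ∩ ⋃ L ∈ {L : Set V8 | (IsLine L ∧ p ∈ L ∧ L ⊆ Segre) ∨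
          (IsBisecant L ∧ p ∈ L ∧ ∃ σ ∈ SigmaSub, L ∩ Segre ⊆ σ)}, L).ncard = 19 ∧
      {L : Set V8 | IsBisecant L ∧ p ∈ L ∧ ¬∃ σ ∈ SigmaSub, L ∩ Segre ⊆ σ}.ncard = 8 ∧
      (∀ q ∈ Segre, q ∉ (⋃ L ∈ {L : Set V8 | (IsLine L ∧ p ∈ L ∧ L ⊆ Segre) ∨
          (IsBisecant L ∧ p ∈ L ∧ ∃ σ ∈ SigmaSub, L ∩ Segre ⊆ σ)}, L) →
        IsBisecant {p, q, p + q} ∧ ¬∃ σ ∈ SigmaSub, ({p, q, p + q} : Set V8) ∩ Segre ⊆ σ)) ∧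
    {L : Set V8 | IsBisecant L ∧ ¬∃ σ ∈ SigmaSub, L ∩ Segre ⊆ σ}.ncard = 108 := by
  refine ⟨?_, count_all⟩
  intro p hp
  obtain ⟨a, rfl⟩ := segre_eq hp
  refine ⟨?_, ?_, ?_, ?_, ?_⟩
  · simp only [gen_iff]; exact count_gen a
  · simp only [in_iff]; exact count_lin a 2 12 le_rfl (c2 a)
  · have key : (Segre ∩ ⋃ L ∈ {L : Set V8 | (IsLine L ∧ ee a ∈ L ∧ L ⊆ Segre) ∨
          (IsBisecant L ∧ ee a ∈ L ∧ ∃ σ ∈ SigmaSub, L ∩ Segre ⊆ σ)}, L) =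
        ee '' ((Finset.univ.filter fun b => dd a b ≤ 2 : Finset T3) : Set T3) := by
      ext x
      constructor
      · rintro ⟨hx, hu⟩
        obtain ⟨c, rfl⟩ := segre_eq hx
        exact ⟨c, by simpa using (cover_iff a c).1 hu, rfl⟩
      · rintro ⟨c, hc, rfl⟩
        exact ⟨ee_mem c, (cover_iff a c).2 (by simpa using hc)⟩
    rw [key, Set.ncard_image_of_injective _ (fun x y h => ee_inj' x y h),
      Set.ncard_coe_finset, c19]
  · simp only [out_iff]; exact count_lin a 3 8 (by norm_num) (c3 a)
  · intro q hq hn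
    obtain ⟨b, rfl⟩ := segre_eq hq
    rw [cover_iff] at hn
    have := (out_iff a _).2 ⟨b, by have := dd_le a b; omega, rfl⟩
    exact ⟨this.1, this.2.2⟩
end

section
/- The Segre variety S_{1,1,1}(2) ⊂ PG(7,2) has polynomial degree exactly 6: it is the zero set of a squarefree polynomial of degree 6, and of no squarefree polynomial of degree ≤ 5. -/
/-- Evaluation of a squarefree (multilinear) polynomial given by its coefficients. -/
def mEval (c : Finset ι3 → ZMod 2) (x : V8) : ZMod 2 :=
  ∑ s : Finset ι3, c s * ∏ i ∈ s, x i

/-- Degree of a squarefree polynomial given by its coefficients. -/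
def mDeg (c : Finset ι3 → ZMod 2) : ℕ :=
  (Finset.univ.filter fun s : Finset ι3 => c s ≠ 0).sup Finset.card

/-- Indicator vector of a set of coordinates. -/
def indV (t : Finset ι3) : V8 := fun i => if i ∈ t then 1 else 0

theorem zmod2_cases (a : ZMod 2) : a = 0 ∨ a = 1 := by
  revert a; decide

theorem indV_surj (x : V8) : ∃ t, x = indV t := by
  refine ⟨Finset.univ.filter fun i => x i = 1, ?_⟩
  funext i
  rcases zmod2_cases (x i) with h | h <;> simp [indV, h]

theorem mEval_indV (c : Finset ι3 → ZMod 2) (u : Finset ι3) :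
    mEval c (indV u) = ∑ s ∈ u.powerset, c s := by
  unfold mEval
  have h : ∀ s : Finset ι3, c s * ∏ i ∈ s, indV u i = if s ∈ u.powerset then c s else 0 := by
    intro s
    split_ifs with hs
    · rw [Finset.mem_powerset] at hs
      rw [Finset.prod_eq_one, mul_one]
      intro i hi
      simp [indV, hs hi]
    · rw [Finset.mem_powerset, Finset.not_subset] at hs
      obtain ⟨i, hi, hu⟩ := hs
      rw [Finset.prod_eq_zero hi, mul_zero]
      simp [indV, hu]
  simp_rw [h]
  rw [Finset.sum_ite_mem, Finset.univ_inter]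

theorem moebius2 (g : Finset ι3 → ZMod 2) (u : Finset ι3) :
    ∑ s ∈ u.powerset, ∑ t ∈ s.powerset, g t = g u := by
  have h : ∑ s ∈ u.powerset, ∑ t ∈ s.powerset, g t
      = ∑ t ∈ u.powerset, ∑ s ∈ Finset.Icc t u, g t := by
    apply Finset.sum_comm'
    intro s t
    simp only [Finset.mem_powerset, Finset.mem_Icc, Finset.le_eq_subset]
    exact ⟨fun ⟨a, b⟩ => ⟨⟨b, a⟩, b.trans a⟩, fun ⟨⟨a, b⟩, _⟩ => ⟨b, a⟩⟩
  rw [h, Finset.sum_eq_single u]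
  · simp
  · intro t ht htu
    rw [Finset.mem_powerset] at ht
    rw [Finset.sum_const, Finset.card_Icc_finset ht]
    have hlt : t.card < u.card := Finset.card_lt_card (lt_of_le_of_ne ht htu)
    obtain ⟨k, hk⟩ : ∃ k, u.card - t.card = k + 1 := ⟨u.card - t.card - 1, by omega⟩
    rw [hk, nsmul_eq_mul]
    push_cast
    rw [show (2 : ZMod 2) = 0 from rfl]
    simp
  · simp

/-- Supports of decomposable tensors (zero included). -/
def DD : Finset (Finset ι3) :=
  (Finset.univ : Finset (Finset (Fin 2) × Finset (Fin 2) × Finset (Fin 2))).image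
    fun p => p.1 ×ˢ p.2.1 ×ˢ p.2.2

theorem mem_DD (t : Finset ι3) : t ∈ DD ↔ indV t = 0 ∨ indV t ∈ Segre := by
  have h1 : (indV t = 0 ∨ indV t ∈ Segre) ↔
      ∃ u v w : Fin 2 → ZMod 2, indV t = fun p => u p.1 * v p.2.1 * w p.2.2 := by
    constructor
    · rintro (h | h)
      · exact ⟨0, 0, 0, by rw [h]; funext p; simp⟩
      · exact h.2
    · intro h
      by_cases h0 : indV t = 0
      · exact Or.inl h0
      · exact Or.inr ⟨h0, h⟩
  rw [h1]
  constructor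
  · intro h
    obtain ⟨⟨A, B, C⟩, -, rfl⟩ := Finset.mem_image.1 h
    refine ⟨fun i => if i ∈ A then 1 else 0, fun i => if i ∈ B then 1 else 0,
      fun i => if i ∈ C then 1 else 0, ?_⟩
    funext p
    by_cases ha : p.1 ∈ A <;> by_cases hb : p.2.1 ∈ B <;> by_cases hc : p.2.2 ∈ C <;>
      simp [indV, ha, hb, hc]
  · rintro ⟨u, v, w, h⟩
    refine Finset.mem_image.2 ⟨(Finset.univ.filter fun i => u i = 1,
      Finset.univ.filter fun i => v i = 1, Finset.univ.filter fun i => w i = 1),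
      Finset.mem_univ _, ?_⟩
    ext p
    have hp := congrFun h p
    simp only [Finset.mem_product, Finset.mem_filter, Finset.mem_univ, true_and]
    rcases zmod2_cases (u p.1) with ha | ha <;> rcases zmod2_cases (v p.2.1) with hb | hb <;>
      rcases zmod2_cases (w p.2.2) with hc | hc <;>
      by_cases ht : p ∈ t <;> simp_all [indV]

theorem sum_formula (s : Finset ι3) (hs : s.Nonempty) :
    ∑ t ∈ s.powerset, (if t ∈ DD then (0 : ZMod 2) else 1)
      = ((DD.filter fun t => t ⊆ s).card : ZMod 2) := by
  have h : ∀ t : Finset ι3, (if t ∈ DD then (0 : ZMod 2) else 1)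
      = 1 + if t ∈ DD then 1 else 0 := by
    intro t; split_ifs <;> rfl
  simp_rw [h]
  rw [Finset.sum_add_distrib, Finset.sum_const, Finset.card_powerset, Finset.sum_boole]
  obtain ⟨k, hk⟩ : ∃ k, s.card = k + 1 := ⟨s.card - 1, by have := hs.card_pos; omega⟩
  rw [hk, nsmul_eq_mul]
  push_cast
  rw [show (2 : ZMod 2) = 0 from rfl]
  have : (s.powerset.filter fun t => t ∈ DD) = DD.filter fun t => t ⊆ s := by
    ext t; simp [and_comm]
  rw [this]; simp

theorem card_full : ((DD.filter fun t => t ⊆ Finset.univ).card : ZMod 2) = 0 := by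
  decide +kernel

theorem card_seven : ∀ p : ι3,
    ((DD.filter fun t => t ⊆ ({p}ᶜ : Finset ι3)).card : ZMod 2) = 0 := by
  decide +kernel

theorem card_six :
    ((DD.filter fun t => t ⊆ ({(0, 0, 0), (1, 1, 1)}ᶜ : Finset ι3)).card : ZMod 2) = 1 := by
  decide +kernel

theorem coeff_eq (c : Finset ι3 → ZMod 2)
    (h : ∀ x, mEval c x = 0 ↔ x = 0 ∨ x ∈ Segre) (s : Finset ι3) :
    c s = ∑ t ∈ s.powerset, (if t ∈ DD then (0 : ZMod 2) else 1) := by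
  rw [← moebius2 c s]
  refine Finset.sum_congr rfl fun t _ => ?_
  rw [← mEval_indV]
  have ht := (h (indV t)).trans (mem_DD t).symm
  split_ifs with hd
  · exact ht.2 hd
  · exact (zmod2_cases _).resolve_left fun h0 => hd (ht.1 h0)

theorem deg_six (c : Finset ι3 → ZMod 2)
    (h : ∀ x, mEval c x = 0 ↔ x = 0 ∨ x ∈ Segre) : mDeg c = 6 := by
  apply le_antisymm
  · apply Finset.sup_le
    intro s hs
    have hc := (Finset.mem_filter.1 hs).2
    by_contra hlt
    have hne : s.Nonempty := by
      rw [← Finset.card_pos]; omega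
    apply hc
    rw [coeff_eq c h s, sum_formula s hne]
    have h8 : s.card + sᶜ.card = 8 := by
      rw [Finset.card_add_card_compl]; rfl
    have h1 : sᶜ.card = 0 ∨ sᶜ.card = 1 := by omega
    rcases h1 with h1 | h1
    · have : s = Finset.univ := by
        rw [Finset.card_eq_zero] at h1
        exact (Finset.compl_eq_empty_iff s).1 h1
      rw [this]; exact card_full
    · obtain ⟨p, hp⟩ := Finset.card_eq_one.1 h1
      have : s = {p}ᶜ := by rw [← hp, compl_compl]
      rw [this]; exact card_seven p
  · have hm : ({(0, 0, 0), (1, 1, 1)}ᶜ : Finset ι3) ∈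
        Finset.univ.filter fun s : Finset ι3 => c s ≠ 0 := by
      rw [Finset.mem_filter]
      refine ⟨Finset.mem_univ _, ?_⟩
      rw [coeff_eq c h, sum_formula _ (by decide), card_six]
      decide
    exact le_trans (by decide) (Finset.le_sup (f := Finset.card) hm)

/-- The Segre variety `S_{1,1,1}(2)` has polynomial degree exactly 6: it is the zero set
(among nonzero vectors) of a squarefree polynomial (vanishing at 0) of degree 6, and of
no such polynomial of degree ≤ 5. -/
theorem stmt16 :
    (∃ c : Finset ι3 → ZMod 2, c ∅ = 0 ∧
      (∀ x, mEval c x = 0 ↔ x = 0 ∨ x ∈ Segre) ∧ mDeg c = 6) ∧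
    (∀ c : Finset ι3 → ZMod 2, c ∅ = 0 →
      (∀ x, mEval c x = 0 ↔ x = 0 ∨ x ∈ Segre) → mDeg c = 6) := by
  refine ⟨?_, fun c _ h => deg_six c h⟩
  have key : ∀ x, mEval (fun s => ∑ t ∈ s.powerset, (if t ∈ DD then (0 : ZMod 2) else 1)) x = 0
      ↔ x = 0 ∨ x ∈ Segre := by
    intro x
    obtain ⟨t, rfl⟩ := indV_surj x
    rw [mEval_indV, moebius2, ← mem_DD]
    split_ifs with hd <;> simp [hd]
  refine ⟨_, ?_, key, deg_six _ key⟩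
  have h0 : (∅ : Finset ι3) ∈ DD :=
    (mem_DD ∅).2 (Or.inl (by funext i; simp [indV]))
  simp [h0]
end
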